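/- arXiv:1811.02450 — 3 statements merged into one kernel-verified Lean document; each statement's English description precedes it below -/
import Mathlib

section
/- Let E be a normed space, M a closed subspace, and F = E/M the quotient space with the quotient norm. Then for every n ≥ 1, c_s(n, F) ≤ c_s(n, E). -/
open scoped BigOperators

noncomputable section

/-- `sup{|L(x₁,…,xₙ)| : all ‖xᵢ‖ ≤ 1}` for an `n`-linear form `L` on `E`. -/
def mNorm {E : Type*} [NormedAddCommGroup E] [NormedSpace ℝ E] {n : ℕ}
    (L : ContinuousMultilinearMap ℝ (fun _ : Fin n => E) ℝ) : ℝ :=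
  sSup {r : ℝ | ∃ x : Fin n → E, (∀ i, ‖x i‖ ≤ 1) ∧ r = |L x|}

/-- `sup{|L(x,…,x)| : ‖x‖ ≤ 1}` for an `n`-linear form `L` on `E`. -/
def qNorm {E : Type*} [NormedAddCommGroup E] [NormedSpace ℝ E] {n : ℕ}
    (L : ContinuousMultilinearMap ℝ (fun _ : Fin n => E) ℝ) : ℝ :=
  sSup {r : ℝ | ∃ x : E, ‖x‖ ≤ 1 ∧ r = |L fun _ => x|}

/-- The polarization constant `c_s(n,E)`, the supremum of `‖L‖/‖L̂‖` over bounded symmetric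
`n`-linear forms `L` on `E` (with the convention `0/0 = 0`, as in Lean's real division). -/
def polConst (n : ℕ) (E : Type*) [NormedAddCommGroup E] [NormedSpace ℝ E] : ℝ :=
  sSup {r : ℝ | ∃ L : ContinuousMultilinearMap ℝ (fun _ : Fin n => E) ℝ,
    (∀ (σ : Equiv.Perm (Fin n)) (x : Fin n → E), L (x ∘ σ) = L x) ∧
    r = mNorm L / qNorm L}

theorem pc_bddM {E : Type*} [NormedAddCommGroup E] [NormedSpace ℝ E] {n : ℕ}
    (L : ContinuousMultilinearMap ℝ (fun _ : Fin n => E) ℝ) :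
    BddAbove {r : ℝ | ∃ x : Fin n → E, (∀ i, ‖x i‖ ≤ 1) ∧ r = |L x|} := by
  refine ⟨‖L‖, ?_⟩
  rintro r ⟨x, hx, rfl⟩
  have h := L.le_opNorm x
  rw [Real.norm_eq_abs] at h
  refine h.trans (mul_le_of_le_one_right (norm_nonneg _) ?_)
  exact Finset.prod_le_one (fun i _ => norm_nonneg _) (fun i _ => hx i)

theorem pc_bddQ {E : Type*} [NormedAddCommGroup E] [NormedSpace ℝ E] {n : ℕ}
    (L : ContinuousMultilinearMap ℝ (fun _ : Fin n => E) ℝ) :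
    BddAbove {r : ℝ | ∃ x : E, ‖x‖ ≤ 1 ∧ r = |L fun _ => x|} := by
  refine (pc_bddM L).mono ?_
  rintro r ⟨x, hx, rfl⟩
  exact ⟨fun _ => x, fun _ => hx, rfl⟩

theorem pc_leM {E : Type*} [NormedAddCommGroup E] [NormedSpace ℝ E] {n : ℕ}
    (L : ContinuousMultilinearMap ℝ (fun _ : Fin n => E) ℝ) (x : Fin n → E)
    (hx : ∀ i, ‖x i‖ ≤ 1) : |L x| ≤ mNorm L :=
  le_csSup (pc_bddM L) ⟨x, hx, rfl⟩

theorem pc_leQ {E : Type*} [NormedAddCommGroup E] [NormedSpace ℝ E] {n : ℕ}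
    (L : ContinuousMultilinearMap ℝ (fun _ : Fin n => E) ℝ) (x : E)
    (hx : ‖x‖ ≤ 1) : |L fun _ => x| ≤ qNorm L :=
  le_csSup (pc_bddQ L) ⟨x, hx, rfl⟩

theorem pc_M_le {E : Type*} [NormedAddCommGroup E] [NormedSpace ℝ E] {n : ℕ}
    (L : ContinuousMultilinearMap ℝ (fun _ : Fin n => E) ℝ) (b : ℝ)
    (h : ∀ x : Fin n → E, (∀ i, ‖x i‖ ≤ 1) → |L x| ≤ b) : mNorm L ≤ b := by
  refine csSup_le ⟨_, 0, by simp, rfl⟩ ?_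
  rintro r ⟨x, hx, rfl⟩
  exact h x hx

theorem pc_Q_le {E : Type*} [NormedAddCommGroup E] [NormedSpace ℝ E] {n : ℕ}
    (L : ContinuousMultilinearMap ℝ (fun _ : Fin n => E) ℝ) (b : ℝ)
    (h : ∀ x : E, ‖x‖ ≤ 1 → |L fun _ => x| ≤ b) : qNorm L ≤ b := by
  refine csSup_le ⟨_, 0, by simp, rfl⟩ ?_
  rintro r ⟨x, hx, rfl⟩
  exact h x hx

theorem pc_lim (n : ℕ) (a b : ℝ) (h : ∀ t : ℝ, 0 < t → t < 1 → t ^ n * a ≤ b) : a ≤ b := by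
  have h1 : Filter.Tendsto (fun t : ℝ => t ^ n * a) (nhdsWithin 1 (Set.Iio 1)) (nhds a) := by
    have : Filter.Tendsto (fun t : ℝ => t ^ n * a) (nhds 1) (nhds (1 ^ n * a)) :=
      Continuous.tendsto (by fun_prop) 1
    rw [one_pow, one_mul] at this
    exact this.mono_left nhdsWithin_le_nhds
  refine le_of_tendsto h1 ?_
  filter_upwards [Ioo_mem_nhdsLT (zero_lt_one : (0:ℝ) < 1)] with t ht
  exact h t ht.1 ht.2

theorem pc_smul {E : Type*} [NormedAddCommGroup E] [NormedSpace ℝ E] {n : ℕ}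
    (L : ContinuousMultilinearMap ℝ (fun _ : Fin n => E) ℝ) (t : ℝ) (x : Fin n → E) :
    L (fun i => t • x i) = t ^ n * L x := by
  have := L.map_smul_univ (fun _ => t) x
  simpa using this

theorem pc_coef (n : ℕ) (r : Fin n → Fin n) :
    ∑ s : Finset (Fin n), (-1 : ℝ) ^ s.card * (if ∀ j, r j ∈ s then 1 else 0)
      = if Function.Bijective r then (-1 : ℝ) ^ n else 0 := by
  classical
  have h := Fintype.prod_add (fun _ : Fin n => (-1 : ℝ)) (fun i => if ∃ j, r j = i then 0 else 1)
  have h2 : ∀ s : Finset (Fin n), (-1 : ℝ) ^ s.card * (if ∀ j, r j ∈ s then 1 else 0)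
      = (∏ i ∈ s, (-1 : ℝ)) * ∏ i ∈ sᶜ, (if ∃ j, r j = i then (0:ℝ) else 1) := by
    intro s
    rw [Finset.prod_const]
    congr 1
    split_ifs with hs
    · symm
      apply Finset.prod_eq_one
      intro i hi
      rw [if_neg]
      rintro ⟨j, rfl⟩
      exact (Finset.mem_compl.1 hi) (hs j)
    · push Not at hs
      obtain ⟨j, hj⟩ := hs
      symm
      exact Finset.prod_eq_zero (Finset.mem_compl.2 hj) (if_pos ⟨j, rfl⟩)
  rw [Finset.sum_congr rfl (fun s _ => h2 s), ← h]
  split_ifs with hb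
  · have : ∀ i, ((-1:ℝ) + if ∃ j, r j = i then 0 else 1) = -1 := fun i => by
      rw [if_pos (hb.2 i), add_zero]
    simp [this]
  · have : ¬ Function.Surjective r := fun hs => hb (Finite.surjective_iff_bijective.1 hs)
    unfold Function.Surjective at this
    push Not at this
    obtain ⟨i, hi⟩ := this
    apply Finset.prod_eq_zero (Finset.mem_univ i)
    rw [if_neg (by push Not; exact hi)]
    norm_num

theorem pc_polar {E : Type*} [NormedAddCommGroup E] [NormedSpace ℝ E] {n : ℕ}
    (L : ContinuousMultilinearMap ℝ (fun _ : Fin n => E) ℝ)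
    (hL : ∀ (σ : Equiv.Perm (Fin n)) (x : Fin n → E), L (x ∘ σ) = L x) (x : Fin n → E) :
    ∑ s : Finset (Fin n), (-1 : ℝ) ^ s.card * L (fun _ => ∑ i ∈ s, x i)
      = (-1) ^ n * (n.factorial * L x) := by
  classical
  have h1 : ∀ s : Finset (Fin n), (-1 : ℝ) ^ s.card * L (fun _ => ∑ i ∈ s, x i)
      = ∑ r : Fin n → Fin n,
        ((-1 : ℝ) ^ s.card * (if ∀ j, r j ∈ s then 1 else 0)) * L (x ∘ r) := by
    intro s
    have := L.toMultilinearMap.map_sum_finset (fun _ i => x i) (fun _ : Fin n => s)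
    have h3 : L (fun _ => ∑ i ∈ s, x i) = ∑ r ∈ Fintype.piFinset (fun _ : Fin n => s), L (x ∘ r) :=
      this
    have h4 : Fintype.piFinset (fun _ : Fin n => s)
      = Finset.univ.filter (fun r : Fin n → Fin n => ∀ j, r j ∈ s) := by
      ext r; simp
    rw [h3, h4, Finset.sum_filter, Finset.mul_sum]
    refine Finset.sum_congr rfl fun r _ => ?_
    split_ifs <;> simp
  rw [Finset.sum_congr rfl (fun s _ => h1 s), Finset.sum_comm]
  simp_rw [← Finset.sum_mul, pc_coef]
  have h5 : ∀ r : Fin n → Fin n, (if Function.Bijective r then (-1 : ℝ) ^ n else 0) * L (x ∘ r)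
      = if Function.Bijective r then (-1 : ℝ) ^ n * L x else 0 := by
    intro r
    split_ifs with hr
    · have := hL (Equiv.ofBijective r hr) x
      rw [← this]; rfl
    · simp
  rw [Finset.sum_congr rfl (fun r _ => h5 r), ← Finset.sum_filter, Finset.sum_const]
  have h6 : (Finset.univ.filter (fun r : Fin n → Fin n => Function.Bijective r)).card
      = n.factorial := by
    rw [← Fintype.card_subtype, Fintype.card_congr (Equiv.ofBijective
      (fun e : Equiv.Perm (Fin n) => (⟨e, e.bijective⟩ : {r : Fin n → Fin n // r.Bijective}))
      ⟨fun a b h => by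
        simpa using h, fun r => ⟨Equiv.ofBijective r.1 r.2, rfl⟩⟩).symm,
      Fintype.card_perm, Fintype.card_fin]
  rw [h6, nsmul_eq_mul]
  ring

theorem pc_bound {E : Type*} [NormedAddCommGroup E] [NormedSpace ℝ E] {n : ℕ} (hn : 1 ≤ n)
    (L : ContinuousMultilinearMap ℝ (fun _ : Fin n => E) ℝ)
    (hL : ∀ (σ : Equiv.Perm (Fin n)) (x : Fin n → E), L (x ∘ σ) = L x) :
    mNorm L ≤ (2 ^ n * n ^ n) * qNorm L := by
  apply pc_M_le
  intro x hx
  have hn0 : (0:ℝ) < n := by exact_mod_cast hn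
  have h1 : ∀ s : Finset (Fin n), |L (fun _ => ∑ i ∈ s, x i)| ≤ n ^ n * qNorm L := by
    intro s
    set y := ∑ i ∈ s, x i with hy
    have hyn : ‖y‖ ≤ n := by
      calc ‖y‖ ≤ ∑ i ∈ s, (1:ℝ) := norm_sum_le_of_le _ (fun i _ => hx i)
        _ = s.card := by simp
        _ ≤ n := by exact_mod_cast (Finset.card_le_univ s).trans (by simp)
    have h := pc_smul L n (fun _ => (n:ℝ)⁻¹ • y)
    have h' : (fun _ : Fin n => (n:ℝ) • (n:ℝ)⁻¹ • y) = fun _ => y := by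
      funext _; rw [smul_inv_smul₀ hn0.ne']
    rw [h'] at h
    rw [h, abs_mul, abs_of_pos (by positivity)]
    gcongr
    apply pc_leQ
    rw [norm_smul, norm_inv, Real.norm_of_nonneg hn0.le]
    exact inv_mul_le_one_of_le₀ hyn hn0.le
  have h2 : |(-1) ^ n * (n.factorial * L x)| ≤ 2 ^ n * (n ^ n * qNorm L) := by
    rw [← pc_polar L hL x]
    refine (Finset.abs_sum_le_sum_abs _ _).trans ?_
    calc _ ≤ ∑ s : Finset (Fin n), (n ^ n * qNorm L) := by
          refine Finset.sum_le_sum fun s _ => ?_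
          rw [abs_mul, abs_pow, abs_neg, abs_one, one_pow, one_mul]
          exact h1 s
      _ = _ := by simp
  rw [abs_mul, abs_pow, abs_neg, abs_one, one_pow, one_mul, abs_mul, Nat.abs_cast] at h2
  have h3 : (1:ℝ) ≤ n.factorial := by exact_mod_cast n.factorial_pos
  nlinarith [abs_nonneg (L x)]

theorem pc_qnonneg {E : Type*} [NormedAddCommGroup E] [NormedSpace ℝ E] {n : ℕ}
    (L : ContinuousMultilinearMap ℝ (fun _ : Fin n => E) ℝ) : 0 ≤ qNorm L :=
  (abs_nonneg _).trans (pc_leQ L 0 (by simp))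

theorem pc_lift {E : Type*} [NormedAddCommGroup E] [NormedSpace ℝ E]
    (M : Submodule ℝ E) [IsClosed (M : Set E)] (x : E ⧸ M) (hx : ‖x‖ ≤ 1) (t : ℝ)
    (h0 : 0 < t) (h1 : t < 1) : ∃ y : E, M.mkQ y = t • x ∧ ‖y‖ ≤ 1 := by
  obtain ⟨m, hm, hlt⟩ := Submodule.Quotient.norm_mk_lt (t • x) (sub_pos.2 h1)
  refine ⟨m, hm, hlt.le.trans ?_⟩
  rw [norm_smul, Real.norm_of_nonneg h0.le]
  nlinarith

/-- If `F = E/M` is a quotient of `E` by a closed subspace, with the quotient norm, then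
`c_s(n, E/M) ≤ c_s(n, E)`. -/
theorem polConst_quotient_le {E : Type*} [NormedAddCommGroup E] [NormedSpace ℝ E]
    (M : Submodule ℝ E) [IsClosed (M : Set E)] (n : ℕ) (hn : 1 ≤ n) :
    polConst n (E ⧸ M) ≤ polConst n E := by
  refine csSup_le ⟨_, 0, by simp, rfl⟩ ?_
  rintro r ⟨L, hL, rfl⟩
  let π : E →L[ℝ] E ⧸ M := LinearMap.mkContinuous M.mkQ 1 (fun x => by
    rw [one_mul]; exact Submodule.Quotient.norm_mk_le M x)
  have hπ : ∀ x, ‖π x‖ ≤ ‖x‖ := fun x => Submodule.Quotient.norm_mk_le M x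
  let L' : ContinuousMultilinearMap ℝ (fun _ : Fin n => E) ℝ :=
    L.compContinuousLinearMap (fun _ => π)
  have hL' : ∀ x, L' x = L (fun i => π (x i)) := fun x => rfl
  have hm : mNorm L' = mNorm L := by
    apply le_antisymm
    · apply pc_M_le
      intro x hx
      exact pc_leM L _ (fun i => (hπ _).trans (hx i))
    · apply pc_M_le
      intro x hx
      apply pc_lim n
      intro t h0 h1
      choose y hy hy1 using fun i => pc_lift M (x i) (hx i) t h0 h1
      have := pc_leM L' y hy1
      have e : (fun i => π (y i)) = fun i => t • x i := funext hy
      rw [hL', e, pc_smul, abs_mul, abs_of_pos (by positivity)] at this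
      exact this
  have hq : qNorm L' = qNorm L := by
    apply le_antisymm
    · apply pc_Q_le
      intro x hx
      exact pc_leQ L _ ((hπ _).trans hx)
    · apply pc_Q_le
      intro x hx
      apply pc_lim n
      intro t h0 h1
      obtain ⟨y, hy, hy1⟩ := pc_lift M x hx t h0 h1
      have := pc_leQ L' y hy1
      have e : (fun _ : Fin n => π y) = fun i => t • x := funext fun _ => hy
      rw [hL', e, pc_smul, abs_mul, abs_of_pos (by positivity)] at this
      exact this
  rw [← hm, ← hq]
  refine le_csSup ⟨2 ^ n * n ^ n, ?_⟩ ⟨L', ?_, rfl⟩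
  · rintro r ⟨K, hK, rfl⟩
    exact div_le_of_le_mul₀ (pc_qnonneg K) (by positivity) (pc_bound hn K hK)
  · intro σ x
    exact hL σ (fun i => π (x i))

end
end

section
/- Let E be an ordered normed space and n ≥ 1. Then for every x ∈ E, ‖x^⊗n‖_{πs+} ≤ 2^{n−1} · ‖x‖₊ⁿ. Consequently, for every symmetric tensor 𝐱 ∈ E^∨n, ‖𝐱‖_{πs} ≤ ‖𝐱‖_{πs+} ≤ 2^{n−1} · c₊(E)ⁿ · ‖𝐱‖_{πs}. -/
open scoped BigOperators TensorProduct
open PiTensorProduct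

noncomputable section

/-- The projective tensor norm `‖·‖_π` on the `n`-th algebraic tensor power `E^⊗n`. -/
def projNorm {E : Type*} [NormedAddCommGroup E] [NormedSpace ℝ E] (n : ℕ)
    (t : ⨂[ℝ] (_ : Fin n), E) : ℝ :=
  sInf {s : ℝ | ∃ (N : ℕ) (a : Fin N → ℝ) (x : Fin N → Fin n → E),
    t = ∑ k, a k • (⨂ₜ[ℝ] i, x k i) ∧ s = ∑ k, |a k| * ∏ i, ‖x k i‖}

/-- The positive projective tensor norm `‖·‖_{π+}` on `E^⊗n`: only decompositions into
elementary tensors of elements of the positive cone `P` are allowed. -/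
def projNormPos {E : Type*} [NormedAddCommGroup E] [NormedSpace ℝ E] (P : Set E) (n : ℕ)
    (t : ⨂[ℝ] (_ : Fin n), E) : ℝ :=
  sInf {s : ℝ | ∃ (N : ℕ) (a : Fin N → ℝ) (x : Fin N → Fin n → E),
    (∀ k i, x k i ∈ P) ∧ t = ∑ k, a k • (⨂ₜ[ℝ] i, x k i) ∧
    s = ∑ k, |a k| * ∏ i, ‖x k i‖}

/-- The symmetric projective tensor norm `‖·‖_{πs}` (decompositions into tensor powers). -/
def symProjNorm {E : Type*} [NormedAddCommGroup E] [NormedSpace ℝ E] (n : ℕ)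
    (t : ⨂[ℝ] (_ : Fin n), E) : ℝ :=
  sInf {s : ℝ | ∃ (N : ℕ) (a : Fin N → ℝ) (x : Fin N → E),
    t = ∑ k, a k • (⨂ₜ[ℝ] (_ : Fin n), x k) ∧ s = ∑ k, |a k| * ‖x k‖ ^ n}

/-- The positive symmetric projective tensor norm `‖·‖_{πs+}` (decompositions into tensor
powers of elements of the positive cone `P`). -/
def symProjNormPos {E : Type*} [NormedAddCommGroup E] [NormedSpace ℝ E] (P : Set E) (n : ℕ)
    (t : ⨂[ℝ] (_ : Fin n), E) : ℝ :=
  sInf {s : ℝ | ∃ (N : ℕ) (a : Fin N → ℝ) (x : Fin N → E),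
    (∀ k, x k ∈ P) ∧ t = ∑ k, a k • (⨂ₜ[ℝ] (_ : Fin n), x k) ∧
    s = ∑ k, |a k| * ‖x k‖ ^ n}

/-- `‖x‖₊ = inf{‖y‖+‖z‖ : x = y − z, y,z ∈ P}`. -/
def normPlus {E : Type*} [NormedAddCommGroup E] (P : Set E) (x : E) : ℝ :=
  sInf {r : ℝ | ∃ y ∈ P, ∃ z ∈ P, x = y - z ∧ r = ‖y‖ + ‖z‖}

/-- `c₊(E) = sup{‖x‖₊ : ‖x‖ ≤ 1}`. -/
def cPlus {E : Type*} [NormedAddCommGroup E] (P : Set E) : ℝ :=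
  sSup {r : ℝ | ∃ x : E, ‖x‖ ≤ 1 ∧ r = normPlus P x}

/-- `P` is a closed generating cone in `E`, i.e. `E` with `P` is an ordered normed space
with `E = P − P`. -/
def IsGenCone {E : Type*} [NormedAddCommGroup E] [NormedSpace ℝ E] (P : Set E) : Prop :=
  IsClosed P ∧ (∀ x ∈ P, ∀ y ∈ P, x + y ∈ P) ∧
    (∀ (c : ℝ), 0 ≤ c → ∀ x ∈ P, c • x ∈ P) ∧
    ∀ x : E, ∃ y ∈ P, ∃ z ∈ P, x = y - z

/-- `c₊(E)` is finite. -/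
def CPlusFinite {E : Type*} [NormedAddCommGroup E] (P : Set E) : Prop :=
  BddAbove {r : ℝ | ∃ x : E, ‖x‖ ≤ 1 ∧ r = normPlus P x}

/-- `t` has a positive representation of cost at most `s`. -/
def PosRep {E : Type*} [NormedAddCommGroup E] [NormedSpace ℝ E] (P : Set E) (n : ℕ)
    (t : ⨂[ℝ] (_ : Fin n), E) (s : ℝ) : Prop :=
  ∃ (N : ℕ) (a : Fin N → ℝ) (x : Fin N → E),
    (∀ k, x k ∈ P) ∧ t = ∑ k, a k • (⨂ₜ[ℝ] (_ : Fin n), x k) ∧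
    ∑ k, |a k| * ‖x k‖ ^ n ≤ s

section helpers
variable {E : Type*} [NormedAddCommGroup E] [NormedSpace ℝ E] {P : Set E} {n : ℕ}

lemma PosRep.mono {t : ⨂[ℝ] (_ : Fin n), E} {s s' : ℝ} (h : PosRep P n t s) (hs : s ≤ s') :
    PosRep P n t s' := by
  obtain ⟨N, a, x, h1, h2, h3⟩ := h
  exact ⟨N, a, x, h1, h2, h3.trans hs⟩

lemma PosRep.zero : PosRep P n (0 : ⨂[ℝ] (_ : Fin n), E) 0 :=
  ⟨0, Fin.elim0, Fin.elim0, fun k => k.elim0, by simp, by simp⟩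

lemma PosRep.single (a : ℝ) {x : E} (hx : x ∈ P) :
    PosRep P n (a • (⨂ₜ[ℝ] (_ : Fin n), x)) (|a| * ‖x‖ ^ n) :=
  ⟨1, fun _ => a, fun _ => x, fun _ => hx, by simp, by simp⟩

lemma PosRep.add {t u : ⨂[ℝ] (_ : Fin n), E} {s r : ℝ} (h : PosRep P n t s)
    (h' : PosRep P n u r) : PosRep P n (t + u) (s + r) := by
  obtain ⟨N, a, x, h1, h2, h3⟩ := h
  obtain ⟨M, b, y, k1, k2, k3⟩ := h'
  refine ⟨N + M, Fin.append a b, Fin.append x y, ?_, ?_, ?_⟩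
  · intro k
    refine Fin.addCases (fun i => ?_) (fun i => ?_) k
    · simpa using h1 i
    · simpa using k1 i
  · rw [Fin.sum_univ_add]
    simp only [Fin.append_left, Fin.append_right]
    rw [h2, k2]
  · rw [Fin.sum_univ_add]
    simp only [Fin.append_left, Fin.append_right]
    exact add_le_add h3 k3

lemma PosRep.smul {t : ⨂[ℝ] (_ : Fin n), E} {s : ℝ} (c : ℝ) (h : PosRep P n t s) :
    PosRep P n (c • t) (|c| * s) := by
  obtain ⟨N, a, x, h1, h2, h3⟩ := h
  refine ⟨N, fun k => c * a k, x, h1, ?_, ?_⟩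
  · rw [h2, Finset.smul_sum]
    simp only [mul_smul]
  · simp only [abs_mul, mul_assoc]
    rw [← Finset.mul_sum]
    exact mul_le_mul_of_nonneg_left h3 (abs_nonneg c)

lemma PosRep.sum {ι : Type*} (S : Finset ι) {t : ι → ⨂[ℝ] (_ : Fin n), E} {s : ι → ℝ}
    (h : ∀ i ∈ S, PosRep P n (t i) (s i)) : PosRep P n (∑ i ∈ S, t i) (∑ i ∈ S, s i) := by
  classical
  induction S using Finset.induction_on with
  | empty => simpa using PosRep.zero
  | insert i S hi ih =>
    rw [Finset.sum_insert hi, Finset.sum_insert hi]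
    exact (h i (Finset.mem_insert_self _ _)).add
      (ih fun j hj => h j (Finset.mem_insert_of_mem hj))

lemma bdd_pos (P : Set E) (t : ⨂[ℝ] (_ : Fin n), E) :
    BddBelow {s : ℝ | ∃ (N : ℕ) (a : Fin N → ℝ) (x : Fin N → E),
    (∀ k, x k ∈ P) ∧ t = ∑ k, a k • (⨂ₜ[ℝ] (_ : Fin n), x k) ∧
    s = ∑ k, |a k| * ‖x k‖ ^ n} := by
  refine ⟨0, ?_⟩
  rintro s ⟨N, a, x, -, -, rfl⟩
  positivity

lemma PosRep.le {t : ⨂[ℝ] (_ : Fin n), E} {s : ℝ} (h : PosRep P n t s) :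
    symProjNormPos P n t ≤ s := by
  obtain ⟨N, a, x, h1, h2, h3⟩ := h
  exact (csInf_le (bdd_pos P t) ⟨N, a, x, h1, h2, rfl⟩).trans h3

open Polynomial Polynomial.Chebyshev in
lemma T_bound (x : ℝ) (hx : 1 ≤ x) (m : ℕ) : (T ℝ (m + 1 : ℕ)).eval x ≤ 2 ^ m * x ^ (m + 1) := by
  induction m with
  | zero => simp
  | succ m ih =>
    have h1 := one_le_eval_T_real (m : ℤ) hx
    have h2 : (T ℝ ((m + 1 + 1 : ℕ) : ℤ)).eval x
        = 2 * x * (T ℝ ((m + 1 : ℕ) : ℤ)).eval x - (T ℝ (m : ℤ)).eval x := by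
      have := T_add_two ℝ (m : ℤ)
      rw [show ((m + 1 + 1 : ℕ) : ℤ) = (m : ℤ) + 2 by push_cast; ring, this]
      simp
    rw [h2]
    have : 2 * x * (T ℝ ((m + 1 : ℕ) : ℤ)).eval x ≤ 2 * x * (2 ^ m * x ^ (m + 1)) :=
      mul_le_mul_of_nonneg_left ih (by linarith)
    calc _ ≤ 2 * x * (2 ^ m * x ^ (m + 1)) := by linarith
      _ = _ := by ring

open Polynomial Polynomial.Chebyshev in
lemma exists_weights (x : ℝ) (hx : 1 ≤ x) (n : ℕ) (hn : 1 ≤ n) : ∃ c ξ : ℕ → ℝ,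
    (∀ i, ξ i ∈ Set.Icc (-1 : ℝ) 1) ∧
    (∀ k ≤ n, x ^ k = ∑ i ∈ Finset.range (n + 1), c i * ξ i ^ k) ∧
    ∑ i ∈ Finset.range (n + 1), |c i| ≤ 2 ^ (n - 1) * x ^ n := by
  have hinj : Set.InjOn (node n ·) (Finset.range (n + 1)) := (strictAntiOn_node n).injOn
  have key : ∀ p : ℝ[X], p.degree ≤ n → p.eval x = ∑ i ∈ Finset.range (n + 1),
      (Lagrange.basis (Finset.range (n + 1)) (node n ·) i).eval x * p.eval (node n i) := by
    intro p hp
    have h1 := Lagrange.eq_interpolate (f := p) hinj (by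
      rw [Finset.card_range]
      exact lt_of_le_of_lt hp (by exact_mod_cast Nat.lt_succ_self n))
    conv_lhs => rw [h1]
    rw [Lagrange.interpolate_apply, eval_finsetSum]
    refine Finset.sum_congr rfl fun i _ => ?_
    rw [eval_mul, eval_C, mul_comm]
  refine ⟨fun i => (Lagrange.basis (Finset.range (n + 1)) (node n ·) i).eval x, node n,
    fun i => node_mem_Icc, ?_, ?_⟩
  · intro k hk
    have := key (X ^ k) (by rw [degree_X_pow]; exact_mod_cast hk)
    simpa using this
  · have h2 : ∀ i ∈ Finset.range (n + 1),
        |(Lagrange.basis (Finset.range (n + 1)) (node n ·) i).eval x| =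
        (Lagrange.basis (Finset.range (n + 1)) (node n ·) i).eval x *
          (T ℝ n).eval (node n i) := by
      intro i hi
      have hi' : i ≤ n := Finset.mem_range_succ_iff.mp hi
      rw [eval_T_real_node (by simpa using hi')]
      have h3 : 0 ≤ (Lagrange.basis (Finset.range (n + 1)) (node n ·) i).eval x * (-1) ^ i := by
        have h4 := zero_lt_prod_node_sub_node hi'
        have h5 : (Lagrange.basis (Finset.range (n + 1)) (node n ·) i).eval x =
            (∏ j ∈ (Finset.range (n + 1)).erase i, (x - node n j)) *
            (∏ j ∈ (Finset.range (n + 1)).erase i, (node n i - node n j))⁻¹ := by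
          rw [Lagrange.basis, eval_prod, ← Finset.prod_inv_distrib, ← Finset.prod_mul_distrib]
          refine Finset.prod_congr rfl fun j _ => ?_
          simp [Lagrange.basisDivisor, mul_comm]
        have h6 : 0 ≤ ∏ j ∈ (Finset.range (n + 1)).erase i, (x - node n j) :=
          Finset.prod_nonneg fun j _ => by
            have := (node_mem_Icc (n := n) (i := j)).2
            linarith
        rw [h5, mul_assoc]
        refine mul_nonneg h6 ?_
        have h7 := inv_pos.mpr h4
        rw [mul_inv, ← inv_pow] at h7
        norm_num at h7
        rw [mul_comm]
        simpa using h7.le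
      rw [← abs_of_nonneg h3, abs_mul]
      simp
    rw [Finset.sum_congr rfl h2, ← key _ (by simp)]
    obtain ⟨m, rfl⟩ : ∃ m, n = m + 1 := ⟨n - 1, by omega⟩
    exact T_bound x hx m

lemma tensor_interp (A B : E) (x : ℝ) (n : ℕ) (c ξ : ℕ → ℝ)
    (h : ∀ k ≤ n, x ^ k = ∑ i ∈ Finset.range (n + 1), c i * ξ i ^ k) :
    (⨂ₜ[ℝ] (_ : Fin n), (A + x • B)) =
      ∑ i ∈ Finset.range (n + 1), c i • (⨂ₜ[ℝ] (_ : Fin n), (A + ξ i • B)) := by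
  classical
  have hexp : ∀ y : ℝ, (⨂ₜ[ℝ] (_ : Fin n), (A + y • B)) =
      ∑ S : Finset (Fin n), y ^ S.card •
        PiTensorProduct.tprod ℝ (S.piecewise (fun _ => B) (fun _ => A)) := by
    intro y
    have h1 := (PiTensorProduct.tprod ℝ (s := fun _ : Fin n => E)).map_add_univ
      (fun _ => y • B) (fun _ => A)
    have h2 : ((fun _ => y • B) + (fun _ => A) : Fin n → E) = fun _ => A + y • B := by
      funext i; simp [add_comm]
    rw [h2] at h1
    rw [h1]
    refine Finset.sum_congr rfl fun S _ => ?_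
    have h3 := (PiTensorProduct.tprod ℝ (s := fun _ : Fin n => E)).map_piecewise_smul
      (fun _ => y) (S.piecewise (fun _ => B) (fun _ => A)) S
    rw [Finset.prod_const] at h3
    rw [← h3]
    congr 1
    funext i
    by_cases hi : i ∈ S <;> simp [hi]
  rw [hexp]
  simp only [hexp, Finset.smul_sum]
  rw [Finset.sum_comm]
  refine Finset.sum_congr rfl fun S _ => ?_
  rw [h S.card (by simpa using Finset.card_le_univ S), Finset.sum_smul]
  simp only [mul_smul]

lemma tprod_smul_const (c : ℝ) (x : E) :
    (⨂ₜ[ℝ] (_ : Fin n), c • x) = c ^ n • (⨂ₜ[ℝ] (_ : Fin n), x) := by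
  have := (PiTensorProduct.tprod ℝ (s := fun _ : Fin n => E)).map_smul_univ
    (fun _ => c) (fun _ => x)
  simpa using this

lemma posRep_aux (hP : IsGenCone P) (hn : 1 ≤ n) {y z : E} (hy : y ∈ P) (hz : z ∈ P)
    {α β : ℝ} (hyα : ‖y‖ ≤ α) (hzβ : ‖z‖ ≤ β) (hβ : 0 < β) (hαβ : β < α) :
    PosRep P n (⨂ₜ[ℝ] (_ : Fin n), (y - z)) (2 ^ (n - 1) * (α + β) ^ n) := by
  obtain ⟨-, hadd, hsmul, -⟩ := hP
  have hα : 0 < α := hβ.trans hαβ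
  have hd : 0 < α - β := by linarith
  obtain ⟨c, ξ, hξ, hc, hcs⟩ := exists_weights ((α + β) / (α - β))
    (by rw [le_div_iff₀ hd]; linarith) n hn
  set u := α⁻¹ • y with hu
  set v := β⁻¹ • z with hv
  have huP : u ∈ P := hsmul _ (by positivity) _ hy
  have hvP : v ∈ P := hsmul _ (by positivity) _ hz
  have hu1 : ‖u‖ ≤ 1 := by
    rw [hu, norm_smul, Real.norm_of_nonneg (by positivity), inv_mul_le_iff₀ hα]; simpa using hyα
  have hv1 : ‖v‖ ≤ 1 := by
    rw [hv, norm_smul, Real.norm_of_nonneg (by positivity), inv_mul_le_iff₀ hβ]; simpa using hzβ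
  have hyu : y = α • u := by rw [hu, smul_inv_smul₀ hα.ne']
  have hzv : z = β • v := by rw [hv, smul_inv_smul₀ hβ.ne']
  clear_value u v
  have hI := tensor_interp ((1 / 2 : ℝ) • (u + v)) ((1 / 2 : ℝ) • (u - v)) _ n c ξ hc
  have hAB : ∀ s : ℝ, (1 / 2 : ℝ) • (u + v) + s • (1 / 2 : ℝ) • (u - v)
      = ((1 + s) / 2) • u + ((1 - s) / 2) • v := by
    intro s; module
  have e1 : (α - β) * ((1 + (α + β) / (α - β)) / 2) = α := by field_simp; ring
  have e2 : (α - β) * ((1 - (α + β) / (α - β)) / 2) = -β := by field_simp; ring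
  have hxy : y - z = (α - β) • ((1 / 2 : ℝ) • (u + v) +
      ((α + β) / (α - β)) • (1 / 2 : ℝ) • (u - v)) := by
    rw [hAB, smul_add, smul_smul, smul_smul, hyu, hzv, sub_eq_add_neg, ← neg_smul, e1, e2]
  rw [hxy, tprod_smul_const, hI]
  have hsum : PosRep P n (∑ i ∈ Finset.range (n + 1), c i • (⨂ₜ[ℝ] (_ : Fin n),
      ((1 / 2 : ℝ) • (u + v) + ξ i • (1 / 2 : ℝ) • (u - v))))
      (∑ i ∈ Finset.range (n + 1), |c i|) := by
    refine PosRep.sum _ fun i _ => ?_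
    rw [hAB]
    obtain ⟨h1, h2⟩ := hξ i
    have hp : 0 ≤ (1 + ξ i) / 2 := by linarith
    have hq : 0 ≤ (1 - ξ i) / 2 := by linarith
    refine (PosRep.single (c i) (hadd _ (hsmul _ hp _ huP) _ (hsmul _ hq _ hvP))).mono ?_
    refine mul_le_of_le_one_right (abs_nonneg _) (pow_le_one₀ (norm_nonneg _) ?_)
    calc _ ≤ ‖((1 + ξ i) / 2) • u‖ + ‖((1 - ξ i) / 2) • v‖ := norm_add_le _ _
      _ = (1 + ξ i) / 2 * ‖u‖ + (1 - ξ i) / 2 * ‖v‖ := by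
        rw [norm_smul, norm_smul, Real.norm_of_nonneg hp, Real.norm_of_nonneg hq]
      _ ≤ 1 := by nlinarith
  refine (hsum.smul _).mono ?_
  rw [abs_of_pos (by positivity)]
  calc _ ≤ (α - β) ^ n * (2 ^ (n - 1) * ((α + β) / (α - β)) ^ n) :=
        mul_le_mul_of_nonneg_left hcs (by positivity)
    _ = _ := by rw [div_pow]; field_simp

lemma posRep_pow (hP : IsGenCone P) (hn : 1 ≤ n) (x : E) {r : ℝ} (hr : normPlus P x < r) :
    PosRep P n (⨂ₜ[ℝ] (_ : Fin n), x) (2 ^ (n - 1) * r ^ n) := by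
  obtain ⟨y0, hy0, z0, hz0, h0⟩ := hP.2.2.2 x
  obtain ⟨s, ⟨y, hy, z, hz, hxyz, rfl⟩, hsr⟩ := exists_lt_of_csInf_lt
    (⟨_, y0, hy0, z0, hz0, h0, rfl⟩ :
      {r : ℝ | ∃ y ∈ P, ∃ z ∈ P, x = y - z ∧ r = ‖y‖ + ‖z‖}.Nonempty) hr
  have ny := norm_nonneg y
  have nz := norm_nonneg z
  rcases le_total ‖z‖ ‖y‖ with h | h
  · have := posRep_aux (n := n) hP hn hy hz (α := ‖y‖ + 2 * ((r - ‖y‖ - ‖z‖) / 3))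
      (β := ‖z‖ + (r - ‖y‖ - ‖z‖) / 3) (by linarith) (by linarith) (by linarith) (by linarith)
    rw [← hxyz] at this
    refine this.mono (le_of_eq ?_)
    ring
  · have := posRep_aux (n := n) hP hn hz hy (α := ‖z‖ + 2 * ((r - ‖y‖ - ‖z‖) / 3))
      (β := ‖y‖ + (r - ‖y‖ - ‖z‖) / 3) (by linarith) (by linarith) (by linarith) (by linarith)
    have h2 := this.smul ((-1) ^ n)
    rw [← tprod_smul_const, show (-1 : ℝ) • (z - y) = x by rw [hxyz]; module] at h2
    refine h2.mono (le_of_eq ?_)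
    simp only [abs_pow, abs_neg, abs_one, one_pow, one_mul]
    ring

lemma normPlus_bdd (P : Set E) (x : E) :
    BddBelow {r : ℝ | ∃ y ∈ P, ∃ z ∈ P, x = y - z ∧ r = ‖y‖ + ‖z‖} := by
  refine ⟨0, ?_⟩
  rintro r ⟨y, -, z, -, -, rfl⟩
  positivity

lemma normPlus_nonneg (P : Set E) (x : E) : 0 ≤ normPlus P x := by
  refine Real.sInf_nonneg ?_
  rintro r ⟨y, -, z, -, -, rfl⟩
  positivity

open scoped Pointwise in
lemma normPlus_smul_le (hP : IsGenCone P) {c : ℝ} (hc : 0 ≤ c) (x : E) :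
    normPlus P (c • x) ≤ c * normPlus P x := by
  obtain ⟨y0, hy0, z0, hz0, h0⟩ := hP.2.2.2 x
  have : c * normPlus P x = sInf (c • {r : ℝ | ∃ y ∈ P, ∃ z ∈ P, x = y - z ∧ r = ‖y‖ + ‖z‖}) := by
    rw [Real.sInf_smul_of_nonneg hc]; rfl
  rw [this]
  refine le_csInf (Set.Nonempty.smul_set ⟨_, y0, hy0, z0, hz0, h0, rfl⟩) ?_
  rintro _ ⟨_, ⟨y, hy, z, hz, hx, rfl⟩, rfl⟩
  refine csInf_le (normPlus_bdd P _) ⟨c • y, hP.2.2.1 c hc y hy, c • z, hP.2.2.1 c hc z hz, ?_, ?_⟩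
  · rw [hx, smul_sub]
  · simp only [norm_smul, Real.norm_of_nonneg hc, smul_eq_mul]; ring

lemma cPlus_nonneg (P : Set E) : 0 ≤ cPlus P := by
  refine Real.sSup_nonneg ?_
  rintro r ⟨x, -, rfl⟩
  exact normPlus_nonneg P x

lemma normPlus_le (hP : IsGenCone P) (hfin : CPlusFinite P) (x : E) :
    normPlus P x ≤ cPlus P * ‖x‖ := by
  have h1 : normPlus P (‖x‖⁻¹ • x) ≤ cPlus P := by
    refine le_csSup hfin ⟨_, ?_, rfl⟩
    rw [norm_smul, norm_inv, norm_norm]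
    exact inv_mul_le_one
  have h2 : ‖x‖ • ‖x‖⁻¹ • x = x := by
    by_cases hx : x = 0
    · simp [hx]
    · exact smul_inv_smul₀ (norm_ne_zero_iff.mpr hx) x
  have h3 := normPlus_smul_le hP (norm_nonneg x) (‖x‖⁻¹ • x)
  rw [h2] at h3
  calc _ ≤ _ := h3
    _ ≤ ‖x‖ * cPlus P := mul_le_mul_of_nonneg_left h1 (norm_nonneg x)
    _ = _ := mul_comm _ _

lemma le_of_eps {f : ℝ → ℝ} (hf : Continuous f) {a : ℝ} (h : ∀ ε > 0, a ≤ f ε) : a ≤ f 0 := by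
  have h1 : Filter.Tendsto f (nhdsWithin 0 (Set.Ioi 0)) (nhds (f 0)) :=
    hf.continuousAt.tendsto.mono_left nhdsWithin_le_nhds
  exact ge_of_tendsto h1 (Filter.eventually_of_mem self_mem_nhdsWithin fun ε hε => h ε hε)

lemma exists_posRep (hP : IsGenCone P) (hn : 1 ≤ n) (t : ⨂[ℝ] (_ : Fin n), E)
    (ht : t ∈ Submodule.span ℝ {u : ⨂[ℝ] (_ : Fin n), E | ∃ x : E, u = ⨂ₜ[ℝ] (_ : Fin n), x}) :
    ∃ s, PosRep P n t s := by
  induction ht using Submodule.span_induction with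
  | mem u hu =>
    obtain ⟨x, rfl⟩ := hu
    exact ⟨_, posRep_pow hP hn x (lt_add_one _)⟩
  | zero => exact ⟨0, PosRep.zero⟩
  | add u v _ _ hu hv =>
    obtain ⟨s, hs⟩ := hu
    obtain ⟨r, hr⟩ := hv
    exact ⟨_, hs.add hr⟩
  | smul c u _ hu =>
    obtain ⟨s, hs⟩ := hu
    exact ⟨_, hs.smul c⟩

end helpers

/-- For an ordered normed space `E`: `‖x^⊗n‖_{πs+} ≤ 2^{n−1}·‖x‖₊ⁿ` for every `x ∈ E`, and
consequently every symmetric tensor `𝐱 ∈ E^∨n` (i.e. `𝐱` in the span of the tensor powers)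
satisfies `‖𝐱‖_{πs} ≤ ‖𝐱‖_{πs+} ≤ 2^{n−1}·c₊(E)ⁿ·‖𝐱‖_{πs}`. -/
theorem symProjNormPos_pow_le {E : Type*} [NormedAddCommGroup E] [NormedSpace ℝ E]
    (P : Set E) (hP : IsGenCone P) (hfin : CPlusFinite P) (n : ℕ) (hn : 1 ≤ n) :
    (∀ x : E,
        symProjNormPos P n (⨂ₜ[ℝ] (_ : Fin n), x) ≤ 2 ^ (n - 1) * normPlus P x ^ n) ∧
      ∀ t : ⨂[ℝ] (_ : Fin n), E,
        t ∈ Submodule.span ℝ {u : ⨂[ℝ] (_ : Fin n), E | ∃ x : E, u = ⨂ₜ[ℝ] (_ : Fin n), x} →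
        symProjNorm n t ≤ symProjNormPos P n t ∧
          symProjNormPos P n t ≤ 2 ^ (n - 1) * cPlus P ^ n * symProjNorm n t := by
  refine ⟨fun x => ?_, fun t ht => ?_⟩
  · have h := le_of_eps (f := fun ε => 2 ^ (n - 1) * (normPlus P x + ε) ^ n) (by fun_prop)
      (a := symProjNormPos P n (⨂ₜ[ℝ] (_ : Fin n), x))
      (fun ε hε => (posRep_pow hP hn x (lt_add_of_pos_right _ hε)).le)
    simpa using h
  · obtain ⟨s, N, a, x, hx, hta, -⟩ := exists_posRep hP hn t ht
    refine ⟨?_, ?_⟩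
    · refine csInf_le_csInf ?_ ⟨_, N, a, x, hx, hta, rfl⟩ ?_
      · refine ⟨0, ?_⟩
        rintro s ⟨N, a, x, -, rfl⟩
        positivity
      · rintro s ⟨N, a, x, -, h1, h2⟩
        exact ⟨N, a, x, h1, h2⟩
    · have hc := cPlus_nonneg P
      have hK : 0 ≤ 2 ^ (n - 1) * cPlus P ^ n := by positivity
      open scoped Pointwise in
      rw [symProjNorm, ← smul_eq_mul, ← Real.sInf_smul_of_nonneg hK]
      refine le_csInf (Set.Nonempty.smul_set ⟨_, N, a, x, hta, rfl⟩) ?_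
      rintro _ ⟨_, ⟨M, b, y, htb, rfl⟩, rfl⟩
      have h := le_of_eps
        (f := fun ε => ∑ k, |b k| * (2 ^ (n - 1) * (cPlus P * ‖y k‖ + ε) ^ n)) (by fun_prop)
        (a := symProjNormPos P n t) (fun ε hε => by
          rw [htb]
          exact (PosRep.sum _ fun k _ => (posRep_pow hP hn (y k)
            ((normPlus_le hP hfin (y k)).trans_lt (lt_add_of_pos_right _ hε))).smul (b k)).le)
      refine h.trans (le_of_eq ?_)
      simp only [smul_eq_mul, Finset.mul_sum, add_zero, mul_pow]
      refine Finset.sum_congr rfl fun k _ => ?_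
      ring

end
end

section
/- Let n ≥ 1 and a, b ≥ 0, and work in E = ℓ₁². Then ‖(a·e₁ − b·e₂)^⊗n‖_{πs+} = ((√a + √b)^{2n} + (√a − √b)^{2n}) / 2. -/
open scoped BigOperators TensorProduct
open PiTensorProduct

noncomputable section

lemma aux_sum_even_odd {R : Type*} [AddCommMonoid R] (f : ℕ → R) (n : ℕ) :
    ∑ k ∈ Finset.range (2 * n + 1), f k =
      ∑ m ∈ Finset.range (n + 1), f (2 * m) + ∑ m ∈ Finset.range n, f (2 * m + 1) := by
  induction n with
  | zero => simp
  | succ n ih =>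
    rw [show 2 * (n + 1) + 1 = 2 * n + 1 + 1 + 1 by ring, Finset.sum_range_succ,
      Finset.sum_range_succ, ih, Finset.sum_range_succ _ (n + 1),
      Finset.sum_range_succ (fun m => f (2 * m + 1)) n,
      show 2 * (n + 1) = 2 * n + 1 + 1 by ring]
    abel

lemma aux_binom {R : Type*} [CommRing R] (x y : R) (n : ℕ) :
    (x + y) ^ (2 * n) + (x - y) ^ (2 * n) =
      2 * ∑ m ∈ Finset.range (n + 1),
        ((2 * n).choose (2 * m) : R) * (y ^ 2) ^ m * (x ^ 2) ^ (n - m) := by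
  have h1 : ∀ z : R, (x + z) ^ (2 * n) =
      ∑ m ∈ Finset.range (n + 1),
        ((2 * n).choose (2 * m) : R) * (z ^ 2) ^ m * (x ^ 2) ^ (n - m) +
      ∑ m ∈ Finset.range n,
        ((2 * n).choose (2 * m + 1) : R) * ((z ^ 2) ^ m * z) * x ^ (2 * n - (2 * m + 1)) := by
    intro z
    rw [add_comm, add_pow, aux_sum_even_odd]
    congr 1
    · refine Finset.sum_congr rfl fun m _ => ?_
      rw [← Nat.mul_sub, pow_mul, pow_mul]; ring
    · refine Finset.sum_congr rfl fun m _ => ?_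
      rw [pow_succ, pow_mul]; ring
  rw [sub_eq_add_neg, h1, h1]
  simp only [neg_sq, mul_neg, neg_mul, Finset.sum_neg_distrib]
  ring

def auxQ (n : ℕ) (s t : ℝ) : ℝ :=
  ∑ m ∈ Finset.range (n + 1), ((2 * n).choose (2 * m) : ℝ) * (-1) ^ m * (t ^ m * s ^ (n - m))

lemma auxQ_neg (n : ℕ) (a b : ℝ) (ha : 0 ≤ a) (hb : 0 ≤ b) :
    auxQ n a (-b) =
      ((Real.sqrt a + Real.sqrt b) ^ (2 * n) + (Real.sqrt a - Real.sqrt b) ^ (2 * n)) / 2 := by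
  rw [aux_binom, mul_div_cancel_left₀ _ two_ne_zero, Real.sq_sqrt ha, Real.sq_sqrt hb, auxQ]
  refine Finset.sum_congr rfl fun m _ => ?_
  rw [neg_pow b, mul_assoc, mul_assoc, ← mul_assoc ((-1 : ℝ) ^ m), ← mul_pow]
  simp [mul_assoc]

lemma auxQ_sq (n : ℕ) (u v : ℝ) :
    auxQ n (u ^ 2) (v ^ 2) = (((u : ℂ) + v * Complex.I) ^ (2 * n)).re := by
  have h := aux_binom (u : ℂ) (v * Complex.I) n
  have h2 : ((u : ℂ) - v * Complex.I) ^ (2 * n) =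
      (starRingEnd ℂ) (((u : ℂ) + v * Complex.I) ^ (2 * n)) := by
    simp [sub_eq_add_neg]
  have h3 : (∑ m ∈ Finset.range (n + 1),
      ((2 * n).choose (2 * m) : ℂ) * ((v * Complex.I : ℂ) ^ 2) ^ m * ((u : ℂ) ^ 2) ^ (n - m))
      = ((auxQ n (u ^ 2) (v ^ 2) : ℝ) : ℂ) := by
    rw [auxQ]
    push_cast
    refine Finset.sum_congr rfl fun m _ => ?_
    rw [mul_pow (v : ℂ), Complex.I_sq, mul_pow]
    ring
  rw [h3, h2, Complex.add_conj] at h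
  have h4 : (2 * (((u : ℂ) + v * Complex.I) ^ (2 * n)).re : ℝ) = 2 * auxQ n (u ^ 2) (v ^ 2) := by
    exact_mod_cast h
  linarith

lemma auxQ_abs_le (n : ℕ) (s t : ℝ) (hs : 0 ≤ s) (ht : 0 ≤ t) :
    |auxQ n s t| ≤ (s + t) ^ n := by
  have h := auxQ_sq n (Real.sqrt s) (Real.sqrt t)
  rw [Real.sq_sqrt hs, Real.sq_sqrt ht] at h
  rw [h]
  refine (Complex.abs_re_le_norm _).trans ?_
  rw [norm_pow, pow_mul, Complex.sq_norm, Complex.normSq_add_mul_I, Real.sq_sqrt hs,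
    Real.sq_sqrt ht]

lemma auxQ_cos (n : ℕ) (x : ℝ) :
    auxQ n (Real.cos x ^ 2) (Real.sin x ^ 2) = Real.cos (2 * n * x) := by
  rw [auxQ_sq]
  push_cast
  rw [Complex.cos_add_sin_mul_I_pow]
  rw [← Complex.ofReal_re (Real.cos (2 * n * x)), Complex.ofReal_cos]
  push_cast
  have : Complex.sin (2 * n * x) = ((Real.sin (2 * n * x) : ℝ) : ℂ) := by push_cast; rfl
  rw [this, Complex.add_re, Complex.re_ofReal_mul, Complex.I_re, mul_zero, add_zero]

def auxL {n : ℕ} (s : Fin (n + 1) → ℝ) (a c : ℝ) (k : Fin (n + 1)) : ℝ :=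
  ∏ j ∈ Finset.univ.erase k, ((s k - s j)⁻¹ * (a - (a + c) * s j))

lemma aux_lagrange_ne {n : ℕ} (s : Fin (n + 1) → ℝ) (hs : Function.Injective s) (a c : ℝ)
    (hac : a + c ≠ 0) (m : ℕ) (hm : m ≤ n) :
    c ^ m * a ^ (n - m) = ∑ k, auxL s a c k * ((1 - s k) ^ m * s k ^ (n - m)) := by
  set P : Polynomial ℝ := (1 - Polynomial.X) ^ m * Polynomial.X ^ (n - m) with hP
  have hdeg : P.degree < (Finset.univ : Finset (Fin (n + 1))).card := by
    have h1 : P.natDegree ≤ n := by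
      have : (1 - Polynomial.X : Polynomial ℝ).natDegree ≤ 1 := by
        compute_degree
      calc P.natDegree ≤ _ := Polynomial.natDegree_mul_le
        _ ≤ m * 1 + (n - m) := by
          gcongr
          · exact Polynomial.natDegree_pow_le.trans (by gcongr)
          · simp
        _ = n := by omega
    refine (Polynomial.degree_le_of_natDegree_le h1).trans_lt ?_
    simp
    exact_mod_cast Nat.lt_succ_self n
  have h := congrArg (Polynomial.eval (a / (a + c))) (Lagrange.eq_interpolate (hs.injOn) hdeg)
  rw [Lagrange.interpolate_apply, Polynomial.eval_finsetSum] at h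
  have hL : ∀ k, auxL s a c k =
      (a + c) ^ n * Polynomial.eval (a / (a + c)) (Lagrange.basis Finset.univ s k) := by
    intro k
    rw [Lagrange.basis, Polynomial.eval_prod, auxL]
    have : (a + c) ^ n = ∏ j ∈ Finset.univ.erase k, (a + c) := by simp
    rw [this, ← Finset.prod_mul_distrib]
    refine Finset.prod_congr rfl fun j _ => ?_
    simp only [Lagrange.basisDivisor, Polynomial.eval_mul, Polynomial.eval_C, Polynomial.eval_sub,
      Polynomial.eval_X]
    field_simp
  have hl : c ^ m * a ^ (n - m) = (a + c) ^ n * Polynomial.eval (a / (a + c)) P := by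
    have e1 : (a + c) ^ n = (a + c) ^ m * (a + c) ^ (n - m) := by
      rw [← pow_add]; congr 1; omega
    simp only [hP, Polynomial.eval_mul, Polynomial.eval_pow, Polynomial.eval_sub,
      Polynomial.eval_one, Polynomial.eval_X]
    rw [e1, mul_mul_mul_comm, ← mul_pow, ← mul_pow]
    congr 2 <;> field_simp
    ring
  rw [hl, h, Finset.mul_sum]
  refine Finset.sum_congr rfl fun k _ => ?_
  rw [hL]
  simp [hP]
  ring

lemma aux_lagrange {n : ℕ} (s : Fin (n + 1) → ℝ) (hs : Function.Injective s) (a c : ℝ)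
    (m : ℕ) (hm : m ≤ n) :
    c ^ m * a ^ (n - m) = ∑ k, auxL s a c k * ((1 - s k) ^ m * s k ^ (n - m)) := by
  have h : (fun a : ℝ => c ^ m * a ^ (n - m)) =
      fun a => ∑ k, auxL s a c k * ((1 - s k) ^ m * s k ^ (n - m)) := by
    refine Continuous.ext_on (dense_compl_singleton (-c)) (by fun_prop)
      (by unfold auxL; fun_prop) ?_
    intro x hx
    refine aux_lagrange_ne s hs x c ?_ m hm
    intro h
    exact hx (by simp; linarith)
  exact congrFun h a

lemma auxL_sign {n : ℕ} (s : Fin (n + 1) → ℝ) (hs : StrictAnti s) (h0 : ∀ k, 0 ≤ s k)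
    (h1 : ∀ k, s k ≤ 1) (a b : ℝ) (ha : 0 ≤ a) (hb : 0 ≤ b) (k : Fin (n + 1)) :
    |auxL s a (-b) k| = (-1) ^ (k : ℕ) * auxL s a (-b) k := by
  have hk : ((-1 : ℝ)) ^ (k : ℕ) = ∏ j ∈ Finset.univ.erase k, (if j < k then (-1 : ℝ) else 1) := by
    rw [Finset.prod_erase _ (by simp), Finset.prod_ite]
    have hc : (Finset.univ.filter (fun x => x < k)) = Finset.Iio k := by ext; simp
    simp [hc]
  have hpos : 0 ≤ (-1) ^ (k : ℕ) * auxL s a (-b) k := by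
    rw [hk, auxL, ← Finset.prod_mul_distrib]
    refine Finset.prod_nonneg fun j hj => ?_
    have hjk : j ≠ k := Finset.ne_of_mem_erase hj
    have hn : 0 ≤ a - (a + -b) * s j := by
      have := mul_nonneg ha (sub_nonneg.2 (h1 j))
      have := mul_nonneg hb (h0 j)
      nlinarith
    rw [← mul_assoc]
    refine mul_nonneg ?_ hn
    split_ifs with hlt
    · have := hs hlt
      have : (s k - s j)⁻¹ ≤ 0 := inv_nonpos.2 (by linarith)
      linarith
    · have := hs (lt_of_le_of_ne (not_lt.1 hlt) hjk.symm)
      have : 0 ≤ (s k - s j)⁻¹ := inv_nonneg.2 (by linarith)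
      linarith
  rw [← abs_of_nonneg hpos, abs_mul]
  simp

lemma aux_tensor (n : ℕ) (x : PiLp 1 fun _ : Fin 2 => ℝ) :
    (⨂ₜ[ℝ] (_ : Fin n), x) = ∑ S : Finset (Fin n), (x 1 ^ S.card * x 0 ^ (n - S.card)) •
      (⨂ₜ[ℝ] i : Fin n, if i ∈ S then WithLp.toLp 1 (![0, 1] : Fin 2 → ℝ) else
        (WithLp.toLp 1 (![1, 0] : Fin 2 → ℝ) : PiLp 1 fun _ : Fin 2 => ℝ)) := by
  have hx : (fun _ : Fin n => x) = (fun _ => x 1 • WithLp.toLp 1 (![0, 1] : Fin 2 → ℝ)) +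
      (fun _ => x 0 • (WithLp.toLp 1 (![1, 0] : Fin 2 → ℝ))) := by
    funext i
    ext j
    fin_cases j <;> simp
  conv_lhs => rw [hx]
  rw [MultilinearMap.map_add_univ]
  refine Finset.sum_congr rfl fun S _ => ?_
  have : S.piecewise (fun _ => x 1 • WithLp.toLp 1 (![0, 1] : Fin 2 → ℝ))
      (fun _ => x 0 • (WithLp.toLp 1 (![1, 0] : Fin 2 → ℝ))) = fun i =>
      (if i ∈ S then x 1 else x 0) • (if i ∈ S then WithLp.toLp 1 (![0, 1] : Fin 2 → ℝ) else
        (WithLp.toLp 1 (![1, 0] : Fin 2 → ℝ) : PiLp 1 fun _ : Fin 2 => ℝ)) := by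
    funext i
    by_cases hi : i ∈ S <;> simp [hi]
  rw [this, MultilinearMap.map_smul_univ]
  congr 1
  rw [Finset.prod_ite]
  simp [Finset.filter_not, Finset.card_sdiff]

def auxF (n m : ℕ) : (⨂[ℝ] (_ : Fin n), (PiLp 1 fun _ : Fin 2 => ℝ)) →ₗ[ℝ] ℝ :=
  PiTensorProduct.lift ((MultilinearMap.mkPiAlgebra ℝ (Fin n) ℝ).compLinearMap fun i =>
    (PiLp.projₗ (𝕜 := ℝ) 1 (fun _ : Fin 2 => ℝ) (if (i : ℕ) < m then 1 else 0)))

lemma auxF_apply (n m : ℕ) (hm : m ≤ n) (x : PiLp 1 fun _ : Fin 2 => ℝ) :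
    auxF n m (⨂ₜ[ℝ] (_ : Fin n), x) = x 1 ^ m * x 0 ^ (n - m) := by
  rw [auxF, PiTensorProduct.lift.tprod]
  simp only [MultilinearMap.compLinearMap_apply, MultilinearMap.mkPiAlgebra_apply,
    PiLp.projₗ_apply]
  have : ∀ i : Fin n, x (if (i : ℕ) < m then 1 else 0) = if (i : ℕ) < m then x 1 else x 0 := by
    intro i; by_cases h : (i : ℕ) < m <;> simp [h]
  simp only [this]
  rw [Fin.prod_univ_eq_prod_range (fun i => if i < m then x 1 else x 0) n]
  obtain ⟨d, rfl⟩ := Nat.exists_eq_add_of_le hm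
  rw [Finset.prod_range_add]
  rw [Finset.prod_congr rfl (g := fun _ => x 1) (fun i hi => by simp [Finset.mem_range.1 hi])]
  simp

/-- In `ℓ₁²` with the coordinatewise order, for `a, b ≥ 0`:
`‖(a·e₁ − b·e₂)^⊗n‖_{πs+} = ((√a + √b)^{2n} + (√a − √b)^{2n})/2`. -/
theorem symProjNormPos_a_neg_b (n : ℕ) (hn : 1 ≤ n) (a b : ℝ) (ha : 0 ≤ a) (hb : 0 ≤ b) :
    symProjNormPos {x : PiLp 1 fun _ : Fin 2 => ℝ | ∀ i, 0 ≤ x i} n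
        (⨂ₜ[ℝ] (_ : Fin n), ((WithLp.equiv 1 (Fin 2 → ℝ)).symm ![a, -b])) =
      ((Real.sqrt a + Real.sqrt b) ^ (2 * n) + (Real.sqrt a - Real.sqrt b) ^ (2 * n)) / 2 := by
  rw [← auxQ_neg n a b ha hb]
  refine IsLeast.csInf_eq ⟨?_, ?_⟩
  · set θ : Fin (n + 1) → ℝ := fun k => (k : ℕ) * Real.pi / (2 * n) with hθ
    set s : Fin (n + 1) → ℝ := fun k => Real.cos (θ k) ^ 2 with hsdef
    have hn0 : (0 : ℝ) < n := by exact_mod_cast hn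
    have hpi := Real.pi_pos
    have hθ0 : ∀ k, 0 ≤ θ k := fun k => by positivity
    have hθ1 : ∀ k, θ k ≤ Real.pi / 2 := fun k => by
      have hk : ((k : ℕ) : ℝ) ≤ n := by exact_mod_cast Nat.lt_succ_iff.1 k.2
      simp only [hθ]
      rw [div_le_div_iff₀ (by positivity) two_pos]
      nlinarith
    have hθm : StrictMono θ := fun i j hij => by
      have : ((i : ℕ) : ℝ) < (j : ℕ) := by exact_mod_cast hij
      simp only [hθ]
      gcongr
    have hs : StrictAnti s := fun i j hij => by
      have h1 := Real.cos_lt_cos_of_nonneg_of_le_pi_div_two (hθ0 i) (hθ1 j) (hθm hij)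
      have h2 : 0 ≤ Real.cos (θ j) :=
        Real.cos_nonneg_of_neg_pi_div_two_le_of_le (by linarith [hθ0 j]) (hθ1 j)
      exact pow_lt_pow_left₀ h1 h2 two_ne_zero
    have hs0 : ∀ k, 0 ≤ s k := fun k => sq_nonneg _
    have hs1 : ∀ k, s k ≤ 1 := fun k => Real.cos_sq_le_one _
    refine ⟨n + 1, auxL s a (-b), fun k => WithLp.toLp 1 ![s k, 1 - s k], ?_, ?_, ?_⟩
    · intro k i
      fin_cases i
      · simpa using hs0 k
      · simpa using hs1 k
    · rw [aux_tensor]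
      simp_rw [aux_tensor n (WithLp.toLp 1 ![_, _]), Finset.smul_sum]
      rw [Finset.sum_comm]
      refine Finset.sum_congr rfl fun S _ => ?_
      simp_rw [smul_smul]
      rw [← Finset.sum_smul]
      congr 1
      have := aux_lagrange s hs.injective a (-b) S.card (by simpa using S.card_le_univ)
      simpa using this
    · have hQ : ∀ k, auxQ n (s k) (1 - s k) = (-1) ^ (k : ℕ) := fun k => by
        have : 1 - s k = Real.sin (θ k) ^ 2 := by
          rw [Real.sin_sq]
        rw [this, auxQ_cos]
        have : 2 * (n : ℝ) * θ k = (k : ℕ) * Real.pi := by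
          simp only [hθ]; field_simp
        rw [this, Real.cos_nat_mul_pi]
      have hnorm : ∀ k, ‖(WithLp.toLp 1 ![s k, 1 - s k] : PiLp 1 fun _ : Fin 2 => ℝ)‖ = 1 := by
        intro k
        rw [PiLp.norm_eq_of_L1]
        simp [Fin.sum_univ_two, abs_of_nonneg (hs0 k), abs_of_nonneg (sub_nonneg.2 (hs1 k))]
      simp_rw [hnorm, auxL_sign s hs hs0 hs1 a b ha hb, ← hQ]
      simp only [auxQ, one_pow, mul_one, Finset.sum_mul]
      rw [Finset.sum_comm]
      refine Finset.sum_congr rfl fun m hm => ?_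
      rw [aux_lagrange s hs.injective a (-b) m (Nat.lt_succ_iff.1 (Finset.mem_range.1 hm)),
        Finset.mul_sum]
      refine Finset.sum_congr rfl fun k _ => ?_
      ring
  · rintro r ⟨N, c, x, hx, ht, rfl⟩
    have key : ∀ m ∈ Finset.range (n + 1), (-b) ^ m * a ^ (n - m) =
        ∑ k, c k * (x k 1 ^ m * x k 0 ^ (n - m)) := by
      intro m hm
      have hm' : m ≤ n := Nat.lt_succ_iff.1 (Finset.mem_range.1 hm)
      have h := congrArg (auxF n m) ht
      rw [map_sum, auxF_apply _ _ hm'] at h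
      simp only [map_smul, auxF_apply _ _ hm', smul_eq_mul] at h
      simpa using h
    have : auxQ n a (-b) = ∑ k, c k * auxQ n (x k 0) (x k 1) := by
      simp only [auxQ, Finset.mul_sum]
      rw [Finset.sum_comm]
      refine Finset.sum_congr rfl fun m hm => ?_
      rw [key m hm, Finset.mul_sum]
      refine Finset.sum_congr rfl fun k _ => ?_
      ring
    rw [this]
    refine Finset.sum_le_sum fun k _ => ?_
    refine (le_abs_self _).trans ?_
    rw [abs_mul]
    refine mul_le_mul_of_nonneg_left ?_ (abs_nonneg _)
    have h := auxQ_abs_le n (x k 0) (x k 1) (hx k 0) (hx k 1)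
    rw [PiLp.norm_eq_of_L1, Fin.sum_univ_two, Real.norm_of_nonneg (hx k 0),
      Real.norm_of_nonneg (hx k 1)]
    exact h

end
end
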